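/- For every b ∈ ℂ with b ∉ {q^{−k−1/2} : k ∈ ℕ}: A_{q²}(−b²) = (b q^{1/2}; q)_∞ · Σ_{n=0}^∞ q^{n²/2} b^n / ((q;q)_n (b q^{1/2};q)_n), where A_{q²}(−b²) = Σ_{n=0}^∞ q^{2n²} b^{2n}/(q²;q²)_n and q^{1/2}, q^{n²/2} denote exp((1/2) log q), exp((n²/2) log q). -/

import Mathlib

open Complex

/-- The finite q-shifted factorial `(a;q)_n`. -/
noncomputable def qPoch (q a : ℂ) (n : ℕ) : ℂ := ∏ j ∈ Finset.range n, (1 - a * q ^ j)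

/-- The infinite q-shifted factorial `(a;q)_∞`. -/
noncomputable def qPochInf (q a : ℂ) : ℂ := ∏' j : ℕ, (1 - a * q ^ j)

section

open Filter Topology Finset PowerSeries

theorem qPoch_succ (q a : ℂ) (n : ℕ) : qPoch q a (n + 1) = qPoch q a n * (1 - a * q ^ n) :=
  prod_range_succ _ _

@[simp]
theorem qPoch_zero (q a : ℂ) : qPoch q a 0 = 1 := prod_range_zero _

theorem norm_sq_lt_one {s : ℂ} (hs : ‖s‖ < 1) : ‖s ^ 2‖ < 1 := by
  rw [norm_pow]
  exact pow_lt_one₀ (norm_nonneg s) hs two_ne_zero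

theorem one_sub_pow_succ_ne_zero {q : ℂ} (hq : ‖q‖ < 1) (n : ℕ) : 1 - q ^ (n + 1) ≠ 0 := by
  intro h
  have h1 : ‖q ^ (n + 1)‖ < 1 := by
    rw [norm_pow]
    exact pow_lt_one₀ (norm_nonneg q) hq n.succ_ne_zero
  rw [← sub_eq_zero.mp h] at h1
  simp at h1

theorem qPoch_self_succ (q : ℂ) (n : ℕ) :
    qPoch q q (n + 1) = qPoch q q n * (1 - q ^ (n + 1)) := by
  rw [qPoch_succ, pow_succ']

theorem qPoch_self_ne_zero {q : ℂ} (hq : ‖q‖ < 1) (n : ℕ) : qPoch q q n ≠ 0 := by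
  refine prod_ne_zero_iff.mpr fun j _ => ?_
  rw [← pow_succ']
  exact one_sub_pow_succ_ne_zero hq j

theorem multipliable_one_sub_mul_pow {q : ℂ} (hq : ‖q‖ < 1) (a : ℂ) :
    Multipliable fun j : ℕ => 1 - a * q ^ j := by
  have h : Summable fun j : ℕ => ‖-(a * q ^ j)‖ := by
    simpa [norm_mul, norm_pow] using
      (summable_geometric_of_lt_one (norm_nonneg q) hq).mul_left ‖a‖
  simpa [sub_eq_add_neg] using multipliable_one_add_of_summable h

theorem qPochInf_eq_qPoch_mul {q : ℂ} (hq : ‖q‖ < 1) (a : ℂ) (n : ℕ) :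
    qPochInf q a = qPoch q a n * qPochInf q (a * q ^ n) := by
  have h : Multipliable fun j : ℕ => 1 - a * q ^ (j + n) := by
    simpa [pow_add, mul_assoc, mul_comm, mul_left_comm] using
      multipliable_one_sub_mul_pow hq (a * q ^ n)
  unfold qPochInf qPoch
  rw [← Multipliable.prod_mul_tprod_nat_mul' (f := fun j : ℕ => 1 - a * q ^ j) h]
  congr 2
  funext j
  ring

/-- With `q = s²`, the series `∑ s^(n²) cⁿ / (q;q)_n` converges absolutely for every `c`. -/
theorem summable_norm_gaussian_div_qPoch {s : ℂ} (hs : ‖s‖ < 1) (c : ℂ) :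
    Summable fun n : ℕ => ‖s ^ n ^ 2 * c ^ n / qPoch (s ^ 2) (s ^ 2) n‖ := by
  have hq := norm_sq_lt_one hs
  have hp : Tendsto (fun n : ℕ => s ^ n) atTop (𝓝 0) :=
    tendsto_pow_atTop_nhds_zero_of_norm_lt_one hs
  have hlim : Tendsto (fun n : ℕ => ‖s ^ n * s ^ n * s * c / (1 - s ^ n * s ^ n * s ^ 2)‖) atTop
      (𝓝 0) := by
    have h := ((((hp.mul hp).mul_const s).mul_const c).div
      (((hp.mul hp).mul_const (s ^ 2)).const_sub 1) (by simp)).norm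
    simpa using h
  refine summable_of_ratio_norm_eventually_le (r := 1 / 2) (by norm_num) ?_
  filter_upwards [hlim.eventually_le_const (show (0 : ℝ) < 1 / 2 by norm_num)] with n hn
  rw [norm_norm, norm_norm]
  refine le_trans (le_of_eq ?_) (mul_le_mul_of_nonneg_right hn (norm_nonneg _))
  rw [← norm_mul, qPoch_self_succ]
  have h1 := qPoch_self_ne_zero hq n
  have h2 := one_sub_pow_succ_ne_zero hq n
  have h3 : 1 - s ^ n * s ^ n * s ^ 2 = 1 - (s ^ 2) ^ (n + 1) := by ring
  rw [h3]
  congr 1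
  field_simp
  ring

theorem tsum_gaussian_div_qPoch_functional_equation {s : ℂ} (hs : ‖s‖ < 1) (c : ℂ) :
    ∑' n : ℕ, s ^ n ^ 2 * (-c) ^ n / qPoch (s ^ 2) (s ^ 2) n =
      (1 - c * s) * ∑' n : ℕ, s ^ n ^ 2 * (-(c * s ^ 2)) ^ n / qPoch (s ^ 2) (s ^ 2) n := by
  have hq := norm_sq_lt_one hs
  have h1 := (summable_norm_gaussian_div_qPoch hs (-c)).of_norm
  have h2 := (summable_norm_gaussian_div_qPoch hs (-(c * s ^ 2))).of_norm
  have h3 := (h1.sub h2).tsum_eq_zero_add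
  rw [h1.tsum_sub h2] at h3
  have h4 : ∀ n : ℕ, s ^ (n + 1) ^ 2 * (-c) ^ (n + 1) / qPoch (s ^ 2) (s ^ 2) (n + 1) -
      s ^ (n + 1) ^ 2 * (-(c * s ^ 2)) ^ (n + 1) / qPoch (s ^ 2) (s ^ 2) (n + 1) =
      -(c * s) * (s ^ n ^ 2 * (-(c * s ^ 2)) ^ n / qPoch (s ^ 2) (s ^ 2) n) := by
    intro n
    have h5 := qPoch_self_ne_zero hq n
    have h6 := one_sub_pow_succ_ne_zero hq n
    rw [qPoch_self_succ]
    generalize qPoch (s ^ 2) (s ^ 2) n = P at *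
    rw [← sub_div, div_eq_iff (mul_ne_zero h5 h6), mul_div_assoc', div_mul_eq_mul_div,
      eq_div_iff h5]
    rw [neg_pow (c * s ^ 2), neg_pow (c * s ^ 2), neg_pow c, mul_pow, mul_pow]
    ring
  simp only [h4, tsum_mul_left] at h3
  simp at h3
  linear_combination h3

/-- Euler's expansion of the infinite `q`-shifted factorial. -/
theorem qPochInf_eq_tsum {s : ℂ} (hs : ‖s‖ < 1) (c : ℂ) :
    qPochInf (s ^ 2) (c * s) = ∑' n : ℕ, s ^ n ^ 2 * (-c) ^ n / qPoch (s ^ 2) (s ^ 2) n := by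
  have hq := norm_sq_lt_one hs
  set F : ℂ → ℂ := fun c => ∑' n : ℕ, s ^ n ^ 2 * (-c) ^ n / qPoch (s ^ 2) (s ^ 2) n with hF
  have hiter : ∀ n : ℕ, F c = qPoch (s ^ 2) (c * s) n * F (c * (s ^ 2) ^ n) := by
    intro n
    induction n with
    | zero => simp
    | succ n ih =>
      rw [ih, qPoch_succ]
      have h := tsum_gaussian_div_qPoch_functional_equation hs (c * (s ^ 2) ^ n)
      have h' : F (c * (s ^ 2) ^ n) =
          (1 - c * (s ^ 2) ^ n * s) * F (c * (s ^ 2) ^ n * s ^ 2) := h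
      rw [h', pow_succ]
      ring_nf
  have hpoch : Tendsto (fun n => qPoch (s ^ 2) (c * s) n) atTop (𝓝 (qPochInf (s ^ 2) (c * s))) :=
    (multipliable_one_sub_mul_pow hq (c * s)).tendsto_prod_tprod_nat
  have hF1 : Tendsto (fun n : ℕ => F (c * (s ^ 2) ^ n)) atTop (𝓝 1) := by
    have hone : ∑' k : ℕ, (if k = 0 then (1 : ℂ) else 0) = 1 := tsum_ite_eq 0 _
    rw [← hone]
    refine tendsto_tsum_of_dominated_convergence (summable_norm_gaussian_div_qPoch hs c) ?_ ?_
    · intro k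
      rcases eq_or_ne k 0 with rfl | hk
      · simp
      · have hlim := tendsto_pow_atTop_nhds_zero_of_norm_lt_one hq
        have h := (((hlim.const_mul c).neg.pow k).const_mul (s ^ k ^ 2)).div_const
          (qPoch (s ^ 2) (s ^ 2) k)
        simpa [hk] using h
    · refine Eventually.of_forall fun n k => ?_
      rw [norm_div, norm_div, norm_mul, norm_mul, norm_pow (-_), norm_neg, norm_mul, norm_pow c]
      gcongr
      refine mul_le_of_le_one_right (norm_nonneg _) ?_
      rw [norm_pow]
      exact pow_le_one₀ (norm_nonneg _) hq.le
  have hlim := hpoch.mul hF1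
  simp only [← hiter, mul_one] at hlim
  exact tendsto_nhds_unique hlim tendsto_const_nhds

/-- The alternating convolution of the reciprocals of `(q;q)_n`. -/
noncomputable def alternatingQConv (q : ℂ) (n : ℕ) : ℂ :=
  ∑ p ∈ antidiagonal n, (qPoch q q p.1)⁻¹ * ((-1) ^ p.2 * (qPoch q q p.2)⁻¹)

theorem alternatingQConv_zero (q : ℂ) : alternatingQConv q 0 = 1 := by
  simp [alternatingQConv]

theorem rescale_mk_inv_qPoch {q : ℂ} (hq : ‖q‖ < 1) :
    rescale q (PowerSeries.mk fun n => (qPoch q q n)⁻¹) =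
      (1 - X) * PowerSeries.mk fun n => (qPoch q q n)⁻¹ := by
  ext n
  rw [sub_mul, one_mul, map_sub]
  cases n with
  | zero => simp
  | succ n =>
    have h5 := qPoch_self_ne_zero hq n
    have h6 := one_sub_pow_succ_ne_zero hq n
    simp only [coeff_rescale, coeff_mk, coeff_succ_X_mul, qPoch_self_succ]
    field_simp
    ring

theorem rescale_mk_alternatingQConv {q : ℂ} (hq : ‖q‖ < 1) :
    rescale q (PowerSeries.mk (alternatingQConv q)) =
      PowerSeries.mk (alternatingQConv q) - X ^ 2 * PowerSeries.mk (alternatingQConv q) := by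
  set e : PowerSeries ℂ := PowerSeries.mk fun n => (qPoch q q n)⁻¹ with he
  have hf : PowerSeries.mk (alternatingQConv q) = e * rescale (-1) e := by
    ext n
    simp [coeff_mul, alternatingQConv, he]
  have h1 : rescale q e = (1 - X) * e := rescale_mk_inv_qPoch hq
  have h2 : rescale q (rescale (-1) e) = (1 + X) * rescale (-1) e := by
    rw [rescale_rescale, mul_comm, ← rescale_rescale, h1, map_mul, map_sub, map_one,
      rescale_neg_one_X, sub_neg_eq_add]
  rw [hf, map_mul, h1, h2]
  ring

theorem alternatingQConv_add_two {q : ℂ} (hq : ‖q‖ < 1) (n : ℕ) :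
    alternatingQConv q (n + 2) = alternatingQConv q n / (1 - q ^ (n + 2)) := by
  have h := congrArg (coeff (n + 2)) (rescale_mk_alternatingQConv hq)
  rw [map_sub, coeff_X_pow_mul, coeff_rescale, coeff_mk, coeff_mk] at h
  rw [eq_div_iff (one_sub_pow_succ_ne_zero hq (n + 1))]
  linear_combination -h

theorem alternatingQConv_odd {q : ℂ} (hq : ‖q‖ < 1) (m : ℕ) :
    alternatingQConv q (2 * m + 1) = 0 := by
  induction m with
  | zero => simp [alternatingQConv, Nat.antidiagonal_succ]
  | succ m ih =>
    rw [show 2 * (m + 1) + 1 = 2 * m + 1 + 2 by ring, alternatingQConv_add_two hq, ih, zero_div]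

/-- Gauss's evaluation of the alternating sum of `q`-binomial coefficients of even order. -/
theorem alternatingQConv_even {q : ℂ} (hq : ‖q‖ < 1) (m : ℕ) :
    alternatingQConv q (2 * m) = (qPoch (q ^ 2) (q ^ 2) m)⁻¹ := by
  induction m with
  | zero => simp [alternatingQConv_zero]
  | succ m ih =>
    rw [mul_add, mul_one, alternatingQConv_add_two hq, ih, qPoch_self_succ, mul_inv, div_eq_mul_inv]
    congr 3
    ring

theorem hasSum_gaussian_alternating {s : ℂ} (hs : ‖s‖ < 1) (b : ℂ) :
    HasSum (fun m : ℕ => s ^ (2 * m) ^ 2 * b ^ (2 * m) / qPoch ((s ^ 2) ^ 2) ((s ^ 2) ^ 2) m)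
      (∑' n : ℕ, s ^ n ^ 2 * b ^ n / qPoch (s ^ 2) (s ^ 2) n *
        qPochInf (s ^ 2) (b * s * (s ^ 2) ^ n)) := by
  have hq := norm_sq_lt_one hs
  set P := qPoch (s ^ 2) (s ^ 2) with hP
  set G : ℕ × ℕ → ℂ := fun p =>
    s ^ p.1 ^ 2 * b ^ p.1 / P p.1 * (s ^ p.2 ^ 2 * (-(b * (s ^ 2) ^ p.1)) ^ p.2 / P p.2) with hG
  have hsum : Summable G := by
    have hb := summable_norm_gaussian_div_qPoch hs b
    refine Summable.of_norm_bounded (hb.mul_norm hb) fun p => ?_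
    rw [norm_mul, norm_mul]
    refine mul_le_mul_of_nonneg_left ?_ (norm_nonneg _)
    rw [norm_div, norm_div, norm_mul, norm_mul, norm_pow (-_), norm_neg, norm_mul, norm_pow b]
    gcongr
    refine mul_le_of_le_one_right (norm_nonneg _) ?_
    rw [norm_pow]
    exact pow_le_one₀ (norm_nonneg _) hq.le
  have hrow : ∑' p, G p = ∑' n : ℕ, s ^ n ^ 2 * b ^ n / P n *
      qPochInf (s ^ 2) (b * s * (s ^ 2) ^ n) := by
    rw [hsum.tsum_prod]
    refine tsum_congr fun n => ?_
    rw [show b * s * (s ^ 2) ^ n = b * (s ^ 2) ^ n * s by ring, qPochInf_eq_tsum hs, ← tsum_mul_left]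
  have hdiag : HasSum (fun N => s ^ N ^ 2 * b ^ N * alternatingQConv (s ^ 2) N) (∑' p, G p) := by
    have h := ((HasAntidiagonal.sigmaAntidiagonalEquivProd (A := ℕ)).hasSum_iff.mpr
      hsum.hasSum).sigma fun N => hasSum_fintype _
    convert h using 1
    funext N
    rw [alternatingQConv, mul_sum, ← sum_coe_sort]
    refine sum_congr rfl fun p _ => ?_
    obtain ⟨⟨n, k⟩, hp⟩ := p
    rw [HasAntidiagonal.mem_antidiagonal] at hp
    subst hp
    simp only [hG, Function.comp, HasAntidiagonal.sigmaAntidiagonalEquivProd_apply, ← hP]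
    rw [neg_pow (b * _), mul_pow]
    ring
  rw [← hrow]
  have heven : ∀ N ∉ Set.range fun m : ℕ => 2 * m,
      s ^ N ^ 2 * b ^ N * alternatingQConv (s ^ 2) N = 0 := by
    intro N hN
    obtain ⟨m, rfl | rfl⟩ := N.even_or_odd'
    · exact absurd ⟨m, rfl⟩ hN
    · rw [alternatingQConv_odd hq, mul_zero]
  convert ((mul_right_injective₀ (two_ne_zero' ℕ)).hasSum_iff heven).mpr hdiag using 1
  funext m
  rw [Function.comp, alternatingQConv_even hq, div_eq_mul_inv]

end

/-- `A_{q²}(−b²) = (bq^{1/2};q)_∞ · Σ_{n≥0} q^{n²/2} b^n/((q;q)_n (bq^{1/2};q)_n)`,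
where `A_{q²}(−b²) = Σ_{n≥0} q^{2n²} b^{2n}/(q²;q²)_n`. -/
theorem ramanujan_function_q_squared (q : ℝ) (hq0 : 0 < q) (hq1 : q < 1) (b : ℂ)
    (hb : ∀ k : ℕ, b ≠ ((q ^ (-(k : ℝ) - 1 / 2) : ℝ) : ℂ)) :
    ∑' n : ℕ, (q : ℂ) ^ (2 * n ^ 2) * b ^ (2 * n) / qPoch ((q : ℂ) ^ 2) ((q : ℂ) ^ 2) n
    = qPochInf (q : ℂ) (b * ((q ^ ((1 : ℝ) / 2) : ℝ) : ℂ)) *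
        ∑' n : ℕ, ((q ^ ((n : ℝ) ^ 2 / 2) : ℝ) : ℂ) * b ^ n /
          (qPoch (q : ℂ) (q : ℂ) n * qPoch (q : ℂ) (b * ((q ^ ((1 : ℝ) / 2) : ℝ) : ℂ)) n) := by
  obtain ⟨s, hs0, hs1, rfl⟩ : ∃ s : ℝ, 0 < s ∧ s < 1 ∧ s ^ 2 = q :=
    ⟨√q, Real.sqrt_pos.mpr hq0, (Real.sqrt_lt' one_pos).mpr (by simpa using hq1),
      Real.sq_sqrt hq0.le⟩
  have hs : ‖(s : ℂ)‖ < 1 := by rwa [Complex.norm_real, Real.norm_of_nonneg hs0.le]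
  have hq := norm_sq_lt_one hs
  have hpow : ∀ x : ℝ, (s ^ 2) ^ (x / 2) = s ^ x := fun x => by
    rw [← Real.rpow_natCast s 2, ← Real.rpow_mul hs0.le]
    congr 1
    push_cast
    ring
  have hhalf : (s ^ 2) ^ ((1 : ℝ) / 2) = s := by rw [hpow, Real.rpow_one]
  have hsq : ∀ n : ℕ, (s ^ 2) ^ ((n : ℝ) ^ 2 / 2) = s ^ n ^ 2 := fun n => by
    rw [hpow, ← Real.rpow_natCast s (n ^ 2), Nat.cast_pow]
  simp only [hhalf, hsq, Complex.ofReal_pow]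
  have hne : ∀ n : ℕ, qPoch ((s : ℂ) ^ 2) (b * s) n ≠ 0 := by
    intro n
    refine Finset.prod_ne_zero_iff.mpr fun k _ hk => hb k ?_
    have hk' : (s ^ 2) ^ (-(k : ℝ) - 1 / 2) = (s * (s ^ 2) ^ k)⁻¹ := by
      rw [sub_eq_add_neg, Real.rpow_add hq0, Real.rpow_neg hq0.le, Real.rpow_neg hq0.le, hhalf,
        Real.rpow_natCast, mul_inv, mul_comm]
    rw [hk', Complex.ofReal_inv]
    refine eq_inv_of_mul_eq_one_left ?_
    push_cast
    linear_combination -hk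
  rw [← tsum_mul_left]
  refine Eq.trans (tsum_congr fun n => ?_)
    ((hasSum_gaussian_alternating hs b).tsum_eq.trans (tsum_congr fun n => ?_))
  · congr 2
    ring
  · rw [qPochInf_eq_qPoch_mul hq (b * s) n]
    have h1 := hne n
    have h2 := qPoch_self_ne_zero hq n
    generalize qPoch ((s : ℂ) ^ 2) (b * s) n = Q at *
    field_simp
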